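/- arXiv:2601.11114 — 4 statements merged into one kernel-verified Lean document; each statement's English description precedes it below -/
import Mathlib

section
/- Let d ≥ 1 be an integer and let Z = {P₀,…,P_d} be d+1 pairwise non-proportional nonzero vectors in ℂ³. Then for a nonzero vector Q ∈ ℂ³ the following are equivalent: (1) there exists a nonzero homogeneous polynomial F ∈ ℂ[x₀,x₁,x₂] of degree d vanishing at every point of Z and vanishing to order at least d at Q; (2) Q lies in the linear span of Pᵢ and P_j for some pair of indices i ≠ j. Equivalently, the degeneracy locus {Q : L(d; dQ + Z) ≠ {0}} is exactly the union of the secant lines of Z. -/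
open MvPolynomial

/-- Iterated partial derivative of `F` with respect to the multi-index `α`:
`∂₀^{α 0} ∂₁^{α 1} ∂₂^{α 2} F`. -/
noncomputable def pd (α : Fin 3 → ℕ) (F : MvPolynomial (Fin 3) ℂ) : MvPolynomial (Fin 3) ℂ :=
  (fun G : MvPolynomial (Fin 3) ℂ => pderiv (0 : Fin 3) G)^[α 0]
    ((fun G : MvPolynomial (Fin 3) ℂ => pderiv (1 : Fin 3) G)^[α 1]
      ((fun G : MvPolynomial (Fin 3) ℂ => pderiv (2 : Fin 3) G)^[α 2] F))

/-- `F` vanishes to order at least `m` at `B`: every iterated partial derivative of `F`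
of total order at most `m - 1` vanishes at `B`. -/
def ordGe (m : ℕ) (B : Fin 3 → ℂ) (F : MvPolynomial (Fin 3) ℂ) : Prop :=
  ∀ α : Fin 3 → ℕ, α 0 + α 1 + α 2 < m → MvPolynomial.eval B (pd α F) = 0


namespace Degen

lemma pderiv_comm' (i j : Fin 3) (F : MvPolynomial (Fin 3) ℂ) :
    pderiv i (pderiv j F) = pderiv j (pderiv i F) := by
  have h : ⁅(pderiv i : Derivation ℂ (MvPolynomial (Fin 3) ℂ) (MvPolynomial (Fin 3) ℂ)),
      (pderiv j : Derivation ℂ (MvPolynomial (Fin 3) ℂ) (MvPolynomial (Fin 3) ℂ))⁆ = 0 := by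
    apply MvPolynomial.derivation_ext
    intro k
    rw [Derivation.commutator_apply]
    simp only [pderiv_X, Pi.single_apply]
    split_ifs <;> simp
  have h2 := congrArg (fun D => D F) h
  simp only [Derivation.commutator_apply, Derivation.coe_zero, Pi.zero_apply] at h2
  exact sub_eq_zero.mp h2

lemma commIter (i j : Fin 3) (n : ℕ) (F : MvPolynomial (Fin 3) ℂ) :
    (fun G : MvPolynomial (Fin 3) ℂ => pderiv i G)^[n] (pderiv j F) =
      pderiv j ((fun G : MvPolynomial (Fin 3) ℂ => pderiv i G)^[n] F) := by
  induction n generalizing F with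
  | zero => rfl
  | succ n ih =>
    rw [Function.iterate_succ_apply, Function.iterate_succ_apply, ← ih]
    exact congrArg _ (pderiv_comm' i j F)

lemma pd_pderiv (α : Fin 3 → ℕ) (i : Fin 3) (F : MvPolynomial (Fin 3) ℂ) :
    pd α (pderiv i F) = pd (Function.update α i (α i + 1)) F := by
  fin_cases i
  · simp [pd, Function.iterate_succ_apply, commIter]
  · simp [pd, Function.iterate_succ_apply, commIter]
  · simp [pd, Function.iterate_succ_apply, commIter]

/-- recursive version of vanishing order -/
def V (Q : Fin 3 → ℂ) : ℕ → MvPolynomial (Fin 3) ℂ → Prop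
  | 0, _ => True
  | m + 1, F => eval Q F = 0 ∧ ∀ i, V Q m (pderiv i F)

lemma ordGe_V (Q : Fin 3 → ℂ) (m : ℕ) (F : MvPolynomial (Fin 3) ℂ) (h : ordGe m Q F) :
    V Q m F := by
  induction m generalizing F with
  | zero => trivial
  | succ m ih =>
    refine ⟨by simpa [pd] using h 0 (by simp), fun i => ih _ ?_⟩
    intro α hα
    rw [pd_pderiv]
    apply h
    fin_cases i <;> simp <;> omega

lemma V_ordGe (Q : Fin 3 → ℂ) (m : ℕ) (F : MvPolynomial (Fin 3) ℂ) (h : V Q m F) :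
    ordGe m Q F := by
  induction m generalizing F with
  | zero => intro α hα; omega
  | succ m ih =>
    intro α hα
    by_cases h0 : ∃ i, α i ≠ 0
    · obtain ⟨i, hi⟩ := h0
      have e : α = Function.update (Function.update α i (α i - 1)) i
          ((Function.update α i (α i - 1)) i + 1) := by
        simp [Nat.sub_add_cancel (Nat.pos_of_ne_zero hi)]
      rw [e, ← pd_pderiv]
      apply ih _ (h.2 i)
      fin_cases i <;> simp at hi ⊢ <;> omega
    · push Not at h0
      simpa [pd, h0] using h.1

lemma V_add (Q : Fin 3 → ℂ) (m : ℕ) (F G : MvPolynomial (Fin 3) ℂ) (h : V Q m F)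
    (h' : V Q m G) : V Q m (F + G) := by
  induction m generalizing F G with
  | zero => trivial
  | succ m ih =>
    refine ⟨by simp [h.1, h'.1], fun i => ?_⟩
    rw [map_add]
    exact ih _ _ (h.2 i) (h'.2 i)

lemma V_C_mul (Q : Fin 3 → ℂ) (m : ℕ) (c : ℂ) (F : MvPolynomial (Fin 3) ℂ) (h : V Q m F) :
    V Q m (C c * F) := by
  induction m generalizing F with
  | zero => trivial
  | succ m ih =>
    refine ⟨by simp [h.1], fun i => ?_⟩
    rw [pderiv_C_mul]
    exact ih _ (h.2 i)

/-- linear form -/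
noncomputable def lin (a : Fin 3 → ℂ) : MvPolynomial (Fin 3) ℂ := ∑ i, C (a i) * X i

lemma pderiv_lin (a : Fin 3 → ℂ) (i : Fin 3) : pderiv i (lin a) = C (a i) := by
  simp [lin, pderiv_C_mul, pderiv_X, Pi.single_apply]

lemma eval_lin (a v : Fin 3 → ℂ) : eval v (lin a) = ∑ i, a i * v i := by simp [lin]

lemma V_lin_mul (Q a : Fin 3 → ℂ) (ha : eval Q (lin a) = 0) (m : ℕ)
    (F : MvPolynomial (Fin 3) ℂ) (h : V Q m F) : V Q (m + 1) (lin a * F) := by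
  induction m generalizing F with
  | zero => exact ⟨by simp [ha], fun i => trivial⟩
  | succ m ih =>
    refine ⟨by simp [ha], fun i => ?_⟩
    rw [pderiv_mul, pderiv_lin]
    exact V_add _ _ _ _ (V_C_mul _ _ _ _ h) (ih _ (h.2 i))

lemma V_prod (Q : Fin 3 → ℂ) (n : ℕ) (a : Fin n → Fin 3 → ℂ)
    (ha : ∀ k, eval Q (lin (a k)) = 0) : V Q n (∏ k, lin (a k)) := by
  induction n with
  | zero => trivial
  | succ n ih =>
    rw [Fin.prod_univ_succ]
    exact V_lin_mul _ _ (ha 0) _ _ (ih _ fun k => ha _)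

lemma lin_ne (a : Fin 3 → ℂ) (ha : a ≠ 0) : lin a ≠ 0 := by
  intro h
  apply ha
  funext i
  have := pderiv_lin a i
  rw [h, map_zero] at this
  simpa using this.symm

lemma lin_hom (a : Fin 3 → ℂ) : (lin a).IsHomogeneous 1 := by
  apply IsHomogeneous.sum
  intro i _
  simpa using (isHomogeneous_C (Fin 3) (a i)).mul (isHomogeneous_X ℂ i)

lemma exists_lin (u v : Fin 3 → ℂ) :
    ∃ a : Fin 3 → ℂ, a ≠ 0 ∧ eval u (lin a) = 0 ∧ eval v (lin a) = 0 := by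
  let M : Matrix (Fin 2) (Fin 3) ℂ := ![u, v]
  have : LinearMap.ker M.mulVecLin ≠ ⊥ := LinearMap.ker_ne_bot_of_finrank_lt (by simp)
  obtain ⟨a, ha, ha0⟩ := (Submodule.ne_bot_iff _).mp this
  have h : M.mulVec a = 0 := by simpa using ha
  refine ⟨a, ha0, ?_, ?_⟩
  · have := congrFun h 0
    simpa [M, Matrix.mulVec, dotProduct, eval_lin, mul_comm] using this
  · have := congrFun h 1
    simpa [M, Matrix.mulVec, dotProduct, eval_lin, mul_comm] using this

/-- restriction to a line -/
noncomputable def res (u w : Fin 3 → ℂ) : MvPolynomial (Fin 3) ℂ →ₐ[ℂ] Polynomial ℂ :=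
  aeval fun i => Polynomial.C (u i) + Polynomial.C (w i) * Polynomial.X

lemma eval_res (u w : Fin 3 → ℂ) (F : MvPolynomial (Fin 3) ℂ) (t : ℂ) :
    (res u w F).eval t = eval (u + t • w) F := by
  induction F using MvPolynomial.induction_on with
  | C a => simp [res]
  | add p q hp hq => simp [hp, hq]
  | mul_X p j hp =>
    rw [map_mul, Polynomial.eval_mul, hp, map_mul]
    simp [res]
    left
    ring

lemma natDegree_l (x y : ℂ) :
    (Polynomial.C x + Polynomial.C y * Polynomial.X).natDegree ≤ 1 := by
  compute_degree

lemma natDegree_res (u w : Fin 3 → ℂ) (F : MvPolynomial (Fin 3) ℂ) (d : ℕ)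
    (hF : F.IsHomogeneous d) : (res u w F).natDegree ≤ d := by
  have := MvPolynomial.aeval_natDegree_le F (m := d) hF.totalDegree_le
    (fun i => Polynomial.C (u i) + Polynomial.C (w i) * Polynomial.X) (n := 1)
    (fun i => natDegree_l _ _)
  simpa [res] using this

lemma natDegree_lp (x y : ℂ) (n : ℕ) :
    ((Polynomial.C x + Polynomial.C y * Polynomial.X) ^ n).natDegree ≤ n := by
  simpa using Polynomial.natDegree_pow_le_of_le n (natDegree_l x y)

lemma coeff_lp (x y : ℂ) (n : ℕ) :
    ((Polynomial.C x + Polynomial.C y * Polynomial.X) ^ n).coeff n = y ^ n := by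
  have := Polynomial.coeff_pow_of_natDegree_le (m := n) (natDegree_l x y)
  simpa using this

lemma coeff_res (u w : Fin 3 → ℂ) (F : MvPolynomial (Fin 3) ℂ) (d : ℕ)
    (hF : F.IsHomogeneous d) : (res u w F).coeff d = eval w F := by
  rw [res, aeval_def, eval₂_eq', eval_eq', Polynomial.finsetSum_coeff]
  apply Finset.sum_congr rfl
  intro m hm
  have hd : m 0 + m 1 + m 2 = d := by
    have := hF (mem_support_iff.mp hm)
    simpa [Finsupp.weight_apply, Finsupp.sum_fintype, Fin.sum_univ_three] using this
  rw [Polynomial.algebraMap_eq, Polynomial.coeff_C_mul, Fin.prod_univ_three,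
    Fin.prod_univ_three, ← hd,
    Polynomial.coeff_mul_add_eq_of_natDegree_le
      (Polynomial.natDegree_mul_le_of_le (natDegree_lp _ _ _) (natDegree_lp _ _ _))
      (natDegree_lp _ _ _),
    Polynomial.coeff_mul_add_eq_of_natDegree_le (natDegree_lp _ _ _) (natDegree_lp _ _ _),
    coeff_lp, coeff_lp, coeff_lp]

lemma deriv_res (u w : Fin 3 → ℂ) (F : MvPolynomial (Fin 3) ℂ) :
    Polynomial.derivative (res u w F) = ∑ i, Polynomial.C (w i) * res u w (pderiv i F) := by
  induction F using MvPolynomial.induction_on with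
  | C a => simp [res]
  | add p q hp hq => simp [hp, hq, mul_add, Finset.sum_add_distrib]
  | mul_X p j hp =>
    rw [map_mul, Polynomial.derivative_mul, hp]
    simp only [pderiv_mul, map_add, map_mul, mul_add, Finset.sum_add_distrib, Finset.sum_mul,
      mul_assoc]
    congr 1
    rw [Finset.sum_eq_single j]
    · simp [res]; ring
    · intro b _ hb
      rw [pderiv_X_of_ne hb.symm]; simp
    · simp

lemma coeff_res_zero (Q w : Fin 3 → ℂ) (m : ℕ) (F : MvPolynomial (Fin 3) ℂ) (h : V Q m F)
    (k : ℕ) (hk : k < m) : (res Q w F).coeff k = 0 := by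
  induction m generalizing F k with
  | zero => omega
  | succ m ih =>
    cases k with
    | zero =>
      rw [Polynomial.coeff_zero_eq_eval_zero, eval_res]
      simpa using h.1
    | succ k =>
      have h1 : (Polynomial.derivative (res Q w F)).coeff k = 0 := by
        rw [deriv_res, Polynomial.finsetSum_coeff]
        apply Finset.sum_eq_zero
        intro i _
        rw [Polynomial.coeff_C_mul, ih _ (h.2 i) k (by omega), mul_zero]
      rw [Polynomial.coeff_derivative] at h1
      rcases mul_eq_zero.mp h1 with h1 | h1
      · exact h1
      · exact absurd h1 (Nat.cast_add_one_ne_zero k)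

lemma eval_smul' (F : MvPolynomial (Fin 3) ℂ) (d : ℕ) (hF : F.IsHomogeneous d) (c : ℂ)
    (v : Fin 3 → ℂ) : eval (c • v) F = c ^ d * eval v F := by
  rw [eval_eq', eval_eq', Finset.mul_sum]
  apply Finset.sum_congr rfl
  intro m hm
  have hd : m 0 + m 1 + m 2 = d := by
    have := hF (mem_support_iff.mp hm)
    simpa [Finsupp.weight_apply, Finsupp.sum_fintype, Fin.sum_univ_three] using this
  rw [← hd]
  simp [Fin.prod_univ_three]
  ring

lemma cone (Q : Fin 3 → ℂ) (F : MvPolynomial (Fin 3) ℂ) (d : ℕ) (hF : F.IsHomogeneous d)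
    (h : V Q d F) (s : ℂ) (v : Fin 3 → ℂ) : eval (s • Q + v) F = eval v F := by
  by_cases hs : s = 0
  · simp [hs]
  have e : res Q v F = Polynomial.C (eval v F) * Polynomial.X ^ d := by
    ext k
    rw [Polynomial.coeff_C_mul, Polynomial.coeff_X_pow]
    rcases lt_trichotomy k d with hk | hk | hk
    · rw [coeff_res_zero Q v d F h k hk, if_neg hk.ne, mul_zero]
    · subst hk
      rw [coeff_res _ _ _ _ hF]; simp
    · rw [if_neg hk.ne', mul_zero]
      exact Polynomial.coeff_eq_zero_of_natDegree_lt ((natDegree_res _ _ _ _ hF).trans_lt hk)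
  have h1 := eval_res Q v F s⁻¹
  have h2 : s • Q + v = s • (Q + s⁻¹ • v) := by
    rw [smul_add, smul_smul, mul_inv_cancel₀ hs, one_smul]
  rw [h2, eval_smul' F d hF, ← h1, e]
  simp
  field_simp

lemma spanning (Q u w : Fin 3 → ℂ) (hw : w ≠ 0) (hu : ∀ c : ℂ, u ≠ c • w)
    (hQ : Q ∉ Submodule.span ℂ {u, w}) (v : Fin 3 → ℂ) :
    ∃ a b c : ℂ, v = a • Q + (b • u + c • w) := by
  have li : LinearIndependent ℂ ![Q, u, w] := by
    rw [Fintype.linearIndependent_iff]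
    intro g hg
    simp only [Fin.sum_univ_three, Matrix.cons_val_zero, Matrix.cons_val_one,
      Matrix.cons_val] at hg
    have g0 : g 0 = 0 := by
      by_contra h0
      apply hQ
      rw [Submodule.mem_span_pair]
      refine ⟨-(g 0)⁻¹ * g 1, -(g 0)⁻¹ * g 2, ?_⟩
      have : Q = (g 0)⁻¹ • (g 0 • Q) := by rw [smul_smul, inv_mul_cancel₀ h0, one_smul]
      rw [this, show g 0 • Q = -(g 1 • u + g 2 • w) by
        rw [eq_neg_iff_add_eq_zero, ← add_assoc, hg]]
      module
    rw [g0, zero_smul, zero_add] at hg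
    have g1 : g 1 = 0 := by
      by_contra h0
      apply hu (-(g 1)⁻¹ * g 2)
      have : u = (g 1)⁻¹ • (g 1 • u) := by rw [smul_smul, inv_mul_cancel₀ h0, one_smul]
      rw [this, show g 1 • u = -(g 2 • w) by rw [eq_neg_iff_add_eq_zero, hg]]
      module
    rw [g1, zero_smul, zero_add] at hg
    have g2 := (smul_eq_zero.mp hg).resolve_right hw
    intro i
    fin_cases i <;> assumption
  have hs := li.span_eq_top_of_card_eq_finrank' (by simp)
  have hv : v ∈ Submodule.span ℂ (Set.range ![Q, u, w]) := hs ▸ Submodule.mem_top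
  obtain ⟨c, hc⟩ := (Submodule.mem_span_range_iff_exists_fun ℂ).mp hv
  refine ⟨c 0, c 1, c 2, ?_⟩
  rw [← hc]
  simp [Fin.sum_univ_three, add_assoc]

/-- If `p = a Q + e p'` then `Q` is on the secant or the points are proportional. -/
lemma no_rel (Q p p' : Fin 3 → ℂ) (hp : ∀ c : ℂ, p ≠ c • p')
    (hQ : Q ∉ Submodule.span ℂ {p, p'}) (a e : ℂ) : p ≠ a • Q + e • p' := by
  intro h
  by_cases ha : a = 0
  · exact hp e (by simpa [ha] using h)
  · apply hQ
    rw [Submodule.mem_span_pair]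
    refine ⟨a⁻¹, -(a⁻¹ * e), ?_⟩
    have : Q = a⁻¹ • (a • Q) := by rw [smul_smul, inv_mul_cancel₀ ha, one_smul]
    rw [this, show a • Q = p - e • p' by rw [h]; simp]
    module

lemma forward (d : ℕ) (hd : 1 ≤ d)
    (P : Fin (d + 1) → (Fin 3 → ℂ)) (hP0 : ∀ r, P r ≠ 0)
    (hprop : ∀ i j, i ≠ j → ∀ c : ℂ, P i ≠ c • P j)
    (Q : Fin 3 → ℂ) (F : MvPolynomial (Fin 3) ℂ) (hF : F.IsHomogeneous d)
    (hv : ∀ r, eval (P r) F = 0) (hV : V Q d F)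
    (hn : ∀ i j, i ≠ j → Q ∉ Submodule.span ℂ {P i, P j}) : F = 0 := by
  have h0l : (0 : Fin (d + 1)) ≠ Fin.last d := by
    intro h
    have := congrArg Fin.val h
    simp at this
    omega
  have sp := spanning Q (P 0) (P (Fin.last d)) (hP0 _) (hprop _ _ h0l) (hn _ _ h0l)
  have hcoord : ∀ r : Fin d, ∃ a b t : ℂ, b ≠ 0 ∧
      P r.castSucc = a • Q + b • (P 0 + t • P (Fin.last d)) := by
    intro r
    obtain ⟨a, b, c, h⟩ := sp (P r.castSucc)
    have hr : r.castSucc ≠ Fin.last d := (Fin.castSucc_lt_last r).ne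
    have hb : b ≠ 0 := by
      rintro rfl
      apply no_rel Q _ _ (hprop _ _ hr) (hn _ _ hr) a c
      simpa using h
    refine ⟨a, b, b⁻¹ * c, hb, ?_⟩
    rw [smul_add, smul_smul, mul_inv_cancel_left₀ hb]
    exact h
  choose a b t hb hP using hcoord
  have tinj : Function.Injective t := by
    intro r s hrs
    by_contra hne
    have hne' : r.castSucc ≠ s.castSucc := fun h => hne (Fin.castSucc_injective _ h)
    apply no_rel Q _ _ (hprop _ _ hne') (hn _ _ hne') (a r - b r * (b s)⁻¹ * a s)
      (b r * (b s)⁻¹)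
    rw [hP r, hP s, hrs, smul_add (b r * (b s)⁻¹), smul_smul (b r * (b s)⁻¹) (b s),
      inv_mul_cancel_right₀ (hb s)]
    module
  have hg : res (P 0) (P (Fin.last d)) F = 0 := by
    refine Polynomial.eq_zero_of_natDegree_lt_card_of_eval_eq_zero _ tinj ?_ ?_
    · intro r
      have h1 := hv r.castSucc
      rw [hP r, cone Q F d hF hV, eval_smul' F d hF] at h1
      rw [eval_res]
      exact (mul_eq_zero.mp h1).resolve_left (pow_ne_zero _ (hb r))
    · rw [Fintype.card_fin]
      refine lt_of_le_of_ne (natDegree_res _ _ _ _ hF) ?_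
      intro he
      have hc := coeff_res (P 0) (P (Fin.last d)) F d hF
      rw [hv] at hc
      have : res (P 0) (P (Fin.last d)) F = 0 := by
        rw [← Polynomial.leadingCoeff_eq_zero, Polynomial.leadingCoeff, he, hc]
      rw [this] at he
      simp at he
      omega
  apply MvPolynomial.funext
  intro v
  rw [map_zero]
  obtain ⟨x, y, z, h⟩ := sp v
  rw [h, cone Q F d hF hV]
  by_cases hy : y = 0
  · rw [hy, zero_smul, zero_add, eval_smul' F d hF, hv, mul_zero]
  · have h2 : y • P 0 + z • P (Fin.last d) = y • (P 0 + (y⁻¹ * z) • P (Fin.last d)) := by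
      rw [smul_add, smul_smul, mul_inv_cancel_left₀ hy]
    rw [h2, eval_smul' F d hF, ← eval_res, hg]
    simp

lemma backward (d : ℕ) (P : Fin (d + 1) → (Fin 3 → ℂ)) (Q : Fin 3 → ℂ) (hQ : Q ≠ 0)
    (i j : Fin (d + 1)) (hij : i ≠ j) (hs : Q ∈ Submodule.span ℂ {P i, P j}) :
    ∃ F : MvPolynomial (Fin 3) ℂ, F ≠ 0 ∧ F.IsHomogeneous d ∧
        (∀ r, eval (P r) F = 0) ∧ ordGe d Q F := by
  obtain ⟨x, y, hxy⟩ := Submodule.mem_span_pair.mp hs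
  -- reduce to the case where the coefficient of `P i` is nonzero
  wlog hx : x ≠ 0 generalizing i j x y
  · refine this j i hij.symm (by rwa [Set.pair_comm]) y x (by rw [add_comm]; exact hxy) ?_
    rintro rfl
    push Not at hx
    apply hQ
    rw [← hxy, hx]; simp
  -- lines through `Q` and the points other than `P i`
  have hl : ∀ k : Fin d, ∃ a : Fin 3 → ℂ, a ≠ 0 ∧ eval Q (lin a) = 0 ∧
      eval (P (i.succAbove k)) (lin a) = 0 := fun k => exists_lin _ _
  choose a ha haQ haP using hl
  refine ⟨∏ k, lin (a k), ?_, ?_, ?_, V_ordGe _ _ _ (V_prod _ _ _ haQ)⟩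
  · exact Finset.prod_ne_zero_iff.mpr fun k _ => lin_ne _ (ha k)
  · simpa using IsHomogeneous.prod Finset.univ (fun k => lin (a k)) (fun _ => 1)
      (fun k _ => lin_hom _)
  · intro r
    rw [map_prod]
    by_cases hr : r = i
    · obtain ⟨k, hk⟩ := Fin.exists_succAbove_eq hij.symm
      apply Finset.prod_eq_zero (Finset.mem_univ k)
      have h1 := haQ k
      have h2 := haP k
      rw [hk] at h2
      rw [← hxy] at h1
      rw [hr]
      simp only [eval_lin, Fin.sum_univ_three, Pi.add_apply, Pi.smul_apply, smul_eq_mul]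
        at h1 h2 ⊢
      have : x * (a k 0 * P i 0 + a k 1 * P i 1 + a k 2 * P i 2) = 0 := by
        linear_combination h1 - y * h2
      exact (mul_eq_zero.mp this).resolve_left hx
    · obtain ⟨k, hk⟩ := Fin.exists_succAbove_eq hr
      apply Finset.prod_eq_zero (Finset.mem_univ k)
      rw [← hk]
      exact haP k

end Degen

/-- For `d + 1` pairwise non-proportional nonzero points and a nonzero point `Q`, there
is a nonzero homogeneous polynomial of degree `d` vanishing at all the points and to order
at least `d` at `Q` if and only if `Q` lies in the linear span of two of the points:
the degeneracy locus is exactly the union of the secant lines. -/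
theorem degeneracy_iff_on_secant (d : ℕ) (hd : 1 ≤ d)
    (P : Fin (d + 1) → (Fin 3 → ℂ)) (hP0 : ∀ r, P r ≠ 0)
    (hprop : ∀ i j, i ≠ j → ∀ c : ℂ, P i ≠ c • P j)
    (Q : Fin 3 → ℂ) (hQ : Q ≠ 0) :
    (∃ F : MvPolynomial (Fin 3) ℂ, F ≠ 0 ∧ F.IsHomogeneous d ∧
        (∀ r, MvPolynomial.eval (P r) F = 0) ∧ ordGe d Q F) ↔
      ∃ i j, i ≠ j ∧ Q ∈ Submodule.span ℂ {P i, P j} := by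
  constructor
  · rintro ⟨F, hF0, hF, hv, ho⟩
    by_contra hn
    push Not at hn
    exact hF0 (Degen.forward d hd P hP0 hprop Q F hF hv (Degen.ordGe_V _ _ _ ho) hn)
  · rintro ⟨i, j, hij, hs⟩
    exact Degen.backward d P Q hQ i j hij hs
end

section
/- Let d ≥ 2 and d ≥ m ≥ t ≥ 1 be integers, let f ∈ ℂ[x₀,x₁,x₂] be an irreducible homogeneous polynomial of degree t defining the curve C = {f = 0}, and let Z be a finite set of nonzero vectors in ℂ³. Set |C| = #{P ∈ Z : f(P) = 0}. Let j be an integer with max{t, td − |C| − (t²−3t)/2 + 1} ≤ j ≤ m, and assume that for every nonzero B ∈ ℂ³ with f(B) = 0, every polynomial in L(d; jB + Z) is divisible by f. Then for every such B one has, in ℤ, dim_ℂ L(d; jB + Z) − (binom(d+2,2) − |Z| − binom(j+1,2)) ≥ |C| + j − td + (t²−3t)/2. (Note that t² − 3t is always even, so (t²−3t)/2 is an integer.) -/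
open MvPolynomial

/-- Iterated partial derivative, as a linear endomorphism of `ℂ[x₀,x₁,x₂]`. -/
noncomputable def pdL (α : Fin 3 → ℕ) :
    MvPolynomial (Fin 3) ℂ →ₗ[ℂ] MvPolynomial (Fin 3) ℂ :=
  ((pderiv (0 : Fin 3)).toLinearMap ^ α 0) ∘ₗ
    ((pderiv (1 : Fin 3)).toLinearMap ^ α 1) ∘ₗ
      ((pderiv (2 : Fin 3)).toLinearMap ^ α 2)

/-- The linear system `L(d; m B + Z)`: homogeneous polynomials of degree `d` vanishing at
every point of `Z` and vanishing to order at least `m` at `B` (i.e. all iterated partial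
derivatives of total order at most `m - 1` vanish at `B`). -/
noncomputable def LSys (d m : ℕ) (B : Fin 3 → ℂ) (Z : Finset (Fin 3 → ℂ)) :
    Submodule ℂ (MvPolynomial (Fin 3) ℂ) :=
  MvPolynomial.homogeneousSubmodule (Fin 3) ℂ d ⊓
    (⨅ P ∈ Z, LinearMap.ker (MvPolynomial.aeval (R := ℂ) P).toLinearMap) ⊓
    (⨅ (α : Fin 3 → ℕ) (_ : α 0 + α 1 + α 2 < m),
      LinearMap.ker ((MvPolynomial.aeval (R := ℂ) B).toLinearMap ∘ₗ pdL α))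

namespace FixedComp

/-- Vanishing to order at least `k` at `B`, recursively. -/
def Van (B : Fin 3 → ℂ) : ℕ → MvPolynomial (Fin 3) ℂ → Prop
  | 0, _ => True
  | k + 1, F => MvPolynomial.eval B F = 0 ∧ ∀ i, Van B k (pderiv i F)

lemma Van.mono {B : Fin 3 → ℂ} {k : ℕ} : ∀ {F}, Van B (k + 1) F → Van B k F := by
  induction k with
  | zero => intro F _; trivial
  | succ k ih => intro F h; exact ⟨h.1, fun i => ih (h.2 i)⟩

lemma Van.mono' {B : Fin 3 → ℂ} {k l : ℕ} (h : k ≤ l) {F} : Van B l F → Van B k F := by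
  induction h with
  | refl => exact id
  | step _ ih => exact fun hF => ih hF.mono

lemma Van.add {B : Fin 3 → ℂ} {k : ℕ} : ∀ {F G}, Van B k F → Van B k G → Van B k (F + G) := by
  induction k with
  | zero => intros; trivial
  | succ k ih =>
    intro F G hF hG
    refine ⟨by simp [hF.1, hG.1], fun i => ?_⟩
    rw [map_add]
    exact ih (hF.2 i) (hG.2 i)

lemma Van.mul_left {B : Fin 3 → ℂ} {k : ℕ} :
    ∀ (H : MvPolynomial (Fin 3) ℂ) {G}, Van B k G → Van B k (H * G) := by
  induction k with
  | zero => intros; trivial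
  | succ k ih =>
    intro H G hG
    refine ⟨by simp [hG.1], fun i => ?_⟩
    rw [pderiv_mul]
    exact (ih _ hG.mono).add (ih _ (hG.2 i))

lemma Van.mul_succ {B : Fin 3 → ℂ} {f : MvPolynomial (Fin 3) ℂ} (hf : MvPolynomial.eval B f = 0)
    {k : ℕ} : ∀ {G}, Van B k G → Van B (k + 1) (f * G) := by
  induction k with
  | zero => intro G _; exact ⟨by simp [hf], fun _ => trivial⟩
  | succ k ih =>
    intro G hG
    refine ⟨by simp [hf], fun i => ?_⟩
    rw [pderiv_mul]
    exact (hG.mul_left _).add (ih (hG.2 i))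

lemma Van.pderiv_pow {B : Fin 3 → ℂ} (i : Fin 3) (n : ℕ) : ∀ {k : ℕ} {F}, Van B (k + n) F →
    Van B k (((pderiv (R := ℂ) i).toLinearMap ^ n) F) := by
  induction n with
  | zero => intro k F h; simpa using h
  | succ n ih =>
    intro k F h
    rw [pow_succ, Module.End.mul_apply]
    exact ih (h.2 i)

lemma Van.pdL {B : Fin 3 → ℂ} {k : ℕ} {F} (h : Van B k F) (α : Fin 3 → ℕ)
    (hα : α 0 + α 1 + α 2 < k) : MvPolynomial.eval B (pdL α F) = 0 := by
  have h' : Van B (0 + 1 + α 0 + α 1 + α 2) F := h.mono' (by omega)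
  exact (((h'.pderiv_pow 2 _).pderiv_pow 1 _).pderiv_pow 0 _).1

lemma pderiv_comm' (i j : Fin 3) :
    Commute (pderiv (R := ℂ) i).toLinearMap (pderiv (R := ℂ) j).toLinearMap := by
  have h : ⁅pderiv (R := ℂ) i, pderiv (R := ℂ) j⁆ = 0 := by
    apply MvPolynomial.derivation_ext
    intro k
    rw [Derivation.commutator_apply]
    simp only [pderiv_X, Pi.single_apply, Derivation.coe_zero, Pi.zero_apply]
    split_ifs <;> simp
  apply LinearMap.ext
  intro F
  have := congrArg (fun D => D F) h
  simp only [Derivation.commutator_apply, Derivation.coe_zero, Pi.zero_apply] at this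
  exact sub_eq_zero.1 this

lemma pdL_eq (α : Fin 3 → ℕ) : pdL α = (pderiv (0 : Fin 3)).toLinearMap ^ α 0 *
    ((pderiv (1 : Fin 3)).toLinearMap ^ α 1 * (pderiv (2 : Fin 3)).toLinearMap ^ α 2) := rfl

lemma pdL_succ (α : Fin 3 → ℕ) (i : Fin 3) :
    pdL (α + Pi.single i 1) = pdL α * (pderiv i).toLinearMap := by
  have h1 := ((pderiv_comm' 0 1).pow_right (α 1)).eq
  have h2 := ((pderiv_comm' 0 2).pow_right (α 2)).eq
  have h3 := ((pderiv_comm' 1 2).pow_right (α 2)).eq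
  simp only [pdL_eq]
  fin_cases i
  · simp [pow_succ, mul_assoc, ← h2]
    rw [← mul_assoc _ _ ((pderiv (2 : Fin 3)).toLinearMap ^ α 2), h1]
    simp [mul_assoc]
  · simp [pow_succ, mul_assoc, ← h3]
  · simp [pow_succ, mul_assoc]

lemma pdL_commute (α : Fin 3 → ℕ) (i : Fin 3) :
    Commute (pderiv i).toLinearMap (pdL α) := by
  rw [pdL_eq]
  exact ((pderiv_comm' i 0).pow_right _).mul_right
    (((pderiv_comm' i 1).pow_right _).mul_right ((pderiv_comm' i 2).pow_right _))

lemma pdL_zero : pdL 0 = 1 := by simp [pdL_eq]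

lemma van_of_pdL {B : Fin 3 → ℂ} {k : ℕ} : ∀ {F},
    (∀ α : Fin 3 → ℕ, α 0 + α 1 + α 2 < k → MvPolynomial.eval B (pdL α F) = 0) → Van B k F := by
  induction k with
  | zero => intros; trivial
  | succ k ih =>
    intro F h
    refine ⟨by simpa [pdL_zero] using h 0 (by simp), fun i => ih fun α hα => ?_⟩
    have := h (α + Pi.single i 1) (by fin_cases i <;> simp <;> omega)
    rw [pdL_succ] at this
    exact this

lemma pow_homog (i : Fin 3) (n : ℕ) : ∀ {e : ℕ} {F : MvPolynomial (Fin 3) ℂ},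
    F.IsHomogeneous e →
    (((pderiv (R := ℂ) i).toLinearMap ^ n) F).IsHomogeneous (e - n) := by
  induction n with
  | zero => intro k F h; simpa using h
  | succ n ih =>
    intro e F h
    rw [pow_succ, Module.End.mul_apply, show e - (n + 1) = e - 1 - n by omega]
    exact ih h.pderiv

lemma pdL_homog (α : Fin 3 → ℕ) {e : ℕ} {F : MvPolynomial (Fin 3) ℂ}
    (h : F.IsHomogeneous e) : (pdL α F).IsHomogeneous (e - (α 0 + α 1 + α 2)) := by
  have := pow_homog 0 (α 0) (pow_homog 1 (α 1) (pow_homog 2 (α 2) h))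
  rwa [show e - (α 0 + α 1 + α 2) = e - α 2 - α 1 - α 0 by omega]

/-- Euler: for a homogeneous form of degree `e ≥ n`, vanishing of the order `n` derivatives
implies vanishing of all the lower ones. -/
lemma euler_down {B : Fin 3 → ℂ} {e n : ℕ} (hn : n ≤ e) {F : MvPolynomial (Fin 3) ℂ}
    (hF : F.IsHomogeneous e)
    (h : ∀ α : Fin 3 → ℕ, α 0 + α 1 + α 2 = n → MvPolynomial.eval B (pdL α F) = 0) :
    ∀ r, ∀ α : Fin 3 → ℕ, α 0 + α 1 + α 2 + r = n → MvPolynomial.eval B (pdL α F) = 0 := by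
  intro r
  induction r with
  | zero => exact h
  | succ r ih =>
    intro α hα
    have hE := congrArg (MvPolynomial.eval B) (pdL_homog α hF).sum_X_mul_pderiv
    have h0 : ∀ i, MvPolynomial.eval B (pderiv i (pdL α F)) = 0 := by
      intro i
      have := ih (α + Pi.single i 1) (by fin_cases i <;> simp <;> omega)
      rw [pdL_succ, ← (pdL_commute α i).eq] at this
      exact this
    simp only [map_sum, map_mul, h0, mul_zero, Finset.sum_const_zero, map_nsmul] at hE
    rcases smul_eq_zero.1 hE.symm with h1 | h1
    · omega
    · exact h1

/-- Index type with `binom(n+1,2)` elements. -/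
abbrev Idx (n : ℕ) := Σ s : Fin n, Fin (s.val + 1)

lemma card_idx (n : ℕ) : Fintype.card (Idx n) = (n + 1).choose 2 := by
  rw [Fintype.card_sigma]
  simp only [Fintype.card_fin]
  rw [Fin.sum_univ_eq_sum_range (fun i => i + 1), Nat.choose_two_right, ← Finset.sum_range_id,
    Finset.sum_range_succ']
  simp

/-- The exponent attached to an index. -/
def ex (n : ℕ) (p : Idx n) : Fin 3 → ℕ := ![p.2.val, p.1.val - p.2.val, n - 1 - p.1.val]

lemma ex_sum {n : ℕ} (p : Idx n) : ex n p 0 + ex n p 1 + ex n p 2 = n - 1 := by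
  obtain ⟨⟨s, hs⟩, ⟨b, hb⟩⟩ := p
  simp [ex]
  simp at hb
  omega

lemma ex_surj {n : ℕ} (hn : 0 < n) (α : Fin 3 → ℕ) (h : α 0 + α 1 + α 2 = n - 1) :
    ∃ p : Idx n, ex n p = α := by
  refine ⟨⟨⟨α 0 + α 1, by omega⟩, ⟨α 0, by simp⟩⟩, ?_⟩
  funext i
  fin_cases i
  · simp [ex]
  · simp [ex]
  · simp [ex]; omega

lemma ex_inj (n : ℕ) : Function.Injective (ex n) := by
  rintro ⟨⟨s, hs⟩, ⟨b, hb⟩⟩ ⟨⟨s', hs'⟩, ⟨b', hb'⟩⟩ h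
  have h0 := congrFun h 0
  have h1 := congrFun h 1
  simp [ex] at h0 h1 hb hb'
  subst h0
  obtain rfl : s = s' := by omega
  rfl

instance finHom (e : ℕ) : FiniteDimensional ℂ (homogeneousSubmodule (Fin 3) ℂ e) :=
  Module.Finite.of_fg (homogeneousSubmodule_fg _ _ e)

lemma finrank_hom (e : ℕ) :
    (e + 2).choose 2 ≤ Module.finrank ℂ (homogeneousSubmodule (Fin 3) ℂ e) := by
  rw [← card_idx (e + 1)]
  let v : Idx (e + 1) → homogeneousSubmodule (Fin 3) ℂ e := fun p =>
    ⟨monomial (Finsupp.equivFunOnFinite.symm (ex (e + 1) p)) 1, by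
      rw [mem_homogeneousSubmodule]
      apply isHomogeneous_monomial
      have := ex_sum p
      simp [Finsupp.degree_eq_sum, Fin.sum_univ_three, this]⟩
  refine LinearIndependent.fintype_card_le_finrank (b := v) ?_
  apply LinearIndependent.of_comp (homogeneousSubmodule (Fin 3) ℂ e).subtype
  have := (basisMonomials (Fin 3) ℂ).linearIndependent.comp
    (fun p => Finsupp.equivFunOnFinite.symm (ex (e + 1) p))
    (Finsupp.equivFunOnFinite.symm.injective.comp (ex_inj _))
  convert this using 1
  funext p
  simp [v]

lemma main_dim (e n : ℕ) (B : Fin 3 → ℂ) (Z : Finset (Fin 3 → ℂ)) (hn : n ≤ e + 1) :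
    ∃ W : Submodule ℂ (MvPolynomial (Fin 3) ℂ), W ≤ homogeneousSubmodule (Fin 3) ℂ e ∧
      (∀ G ∈ W, (∀ P ∈ Z, MvPolynomial.eval P G = 0) ∧ Van B n G) ∧
      (e + 2).choose 2 ≤ Module.finrank ℂ W + Z.card + (n + 1).choose 2 := by
  let φ : homogeneousSubmodule (Fin 3) ℂ e →ₗ[ℂ] (Z ⊕ Idx n → ℂ) :=
    LinearMap.pi fun x => (Sum.elim
      (fun P : Z => (MvPolynomial.aeval (R := ℂ) P.1).toLinearMap)
      (fun p => (MvPolynomial.aeval (R := ℂ) B).toLinearMap ∘ₗ pdL (ex n p)) x) ∘ₗ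
        (homogeneousSubmodule (Fin 3) ℂ e).subtype
  refine ⟨(LinearMap.ker φ).map (homogeneousSubmodule (Fin 3) ℂ e).subtype,
    Submodule.map_subtype_le _ _, ?_, ?_⟩
  · rintro _ ⟨⟨G, hG⟩, hk, rfl⟩
    have hk' : φ ⟨G, hG⟩ = 0 := hk
    refine ⟨fun P hP => ?_, ?_⟩
    · have := congrFun hk' (Sum.inl ⟨P, hP⟩)
      simpa [φ, MvPolynomial.aeval_eq_eval] using this
    · rcases Nat.eq_zero_or_pos n with rfl | hpos
      · trivial
      apply van_of_pdL
      intro α hα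
      refine euler_down (n := n - 1) (by omega) hG ?_ (n - 1 - (α 0 + α 1 + α 2)) α (by omega)
      intro β hβ
      obtain ⟨p, rfl⟩ := ex_surj hpos β hβ
      have := congrFun hk' (Sum.inr p)
      simpa [φ, MvPolynomial.aeval_eq_eval] using this
  · have h1 := LinearMap.finrank_range_add_finrank_ker φ
    have h2 := Submodule.finrank_le (LinearMap.range φ)
    have h3 := finrank_hom e
    rw [Module.finrank_fintype_fun_eq_card, Fintype.card_sum, card_idx, Fintype.card_coe] at h2
    have h4 : Module.finrank ℂ ((LinearMap.ker φ).map
        (homogeneousSubmodule (Fin 3) ℂ e).subtype) = Module.finrank ℂ (LinearMap.ker φ) :=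
      Submodule.finrank_map_subtype_eq _ _
    omega

lemma mem_LSys {d k : ℕ} {B : Fin 3 → ℂ} {Z : Finset (Fin 3 → ℂ)} {F : MvPolynomial (Fin 3) ℂ}
    (h1 : F.IsHomogeneous d) (h2 : ∀ P ∈ Z, MvPolynomial.eval P F = 0) (h3 : Van B k F) :
    F ∈ LSys d k B Z := by
  refine ⟨⟨h1, ?_⟩, ?_⟩
  · simpa [MvPolynomial.aeval_eq_eval] using h2
  · simp only [SetLike.mem_coe, Submodule.mem_iInf]
    intro α hα
    have := h3.pdL α hα
    simpa [MvPolynomial.aeval_eq_eval] using this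

lemma choose_two_int (n : ℕ) : 2 * ((n + 1).choose 2 : ℤ) = (n + 1) * n := by
  have := Nat.triangle_succ n
  have h : (n + 1).choose 2 * 2 = (n + 1) * n := by
    rw [Nat.choose_two_right]
    exact Nat.div_mul_cancel (by simpa [mul_comm] using (Nat.even_mul_succ_self n).two_dvd)
  have h' : (((n + 1).choose 2 * 2 : ℕ) : ℤ) = ((n + 1) * n : ℕ) := by rw [h]
  push_cast at h'
  linarith

lemma key (e t k : ℕ) (f : MvPolynomial (Fin 3) ℂ) (hf0 : f ≠ 0) (hf : f.IsHomogeneous t)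
    (Z ZC : Finset (Fin 3 → ℂ)) (hZC : ∀ P, P ∈ ZC ↔ P ∈ Z ∧ MvPolynomial.eval P f = 0)
    (B : Fin 3 → ℂ) (hB : MvPolynomial.eval B f = 0) :
    (e + 2).choose 2 + ZC.card ≤
      Module.finrank ℂ (LSys (e + t) (k + 1) B Z) + Z.card + (k + 1).choose 2 := by
  classical
  have hsub : ZC ⊆ Z := fun P hP => ((hZC P).1 hP).1
  have hc := Finset.card_sdiff_add_card_eq_card hsub
  by_cases hk : k ≤ e + 1
  · obtain ⟨W, hW, hV, hdim⟩ := main_dim e k B (Z \ ZC) hk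
    have : FiniteDimensional ℂ (LSys (e + t) (k + 1) B Z) :=
      Submodule.finiteDimensional_of_le (S₂ := homogeneousSubmodule (Fin 3) ℂ (e + t))
        (inf_le_left.trans inf_le_left)
    have hle : W.map (LinearMap.mulLeft ℂ f) ≤ LSys (e + t) (k + 1) B Z := by
      rintro _ ⟨G, hG, rfl⟩
      refine mem_LSys ?_ ?_ ?_
      · rw [add_comm e t]; exact hf.mul (hW hG)
      · intro P hP
        by_cases h : MvPolynomial.eval P f = 0
        · simp [h]
        · have := (hV G hG).1 P (by simp [hP, hZC, h])
          simp [this]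
      · exact Van.mul_succ hB (hV G hG).2
    have h1 := Submodule.finrank_mono hle
    have h2 : Module.finrank ℂ (W.map (LinearMap.mulLeft ℂ f)) = Module.finrank ℂ W :=
      (LinearEquiv.finrank_eq (Submodule.equivMapOfInjective (LinearMap.mulLeft ℂ f)
        (fun _ _ h => mul_left_cancel₀ hf0 h) W)).symm
    omega
  · have : (e + 2).choose 2 ≤ (k + 1).choose 2 := Nat.choose_le_choose 2 (by omega)
    omega

end FixedComp

/-- If `f` is an irreducible homogeneous polynomial of degree `t` defining the curve `C`,
`Z` is a finite set of nonzero points with `|C| = #(Z ∩ C)`, and `j` satisfies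
`max{t, td - |C| - (t² - 3t)/2 + 1} ≤ j ≤ m`, and if for every nonzero point `B` of `C`
every member of `L(d; jB + Z)` is divisible by `f`, then for every such `B`
`dim L(d; jB + Z) - (binom(d+2,2) - |Z| - binom(j+1,2)) ≥ |C| + j - td + (t² - 3t)/2`. -/
theorem fixed_component_h_bound (t d m j : ℕ) (hd : 2 ≤ d) (ht : 1 ≤ t)
    (htm : t ≤ m) (hmd : m ≤ d)
    (f : MvPolynomial (Fin 3) ℂ) (hirr : Irreducible f) (hf : f.IsHomogeneous t)
    (Z : Finset (Fin 3 → ℂ)) (hZ : ∀ P ∈ Z, P ≠ 0)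
    (ZC : Finset (Fin 3 → ℂ)) (hZC : ∀ P, P ∈ ZC ↔ P ∈ Z ∧ MvPolynomial.eval P f = 0)
    (hjt : (t : ℤ) ≤ (j : ℤ))
    (hjmin : (t : ℤ) * d - (ZC.card : ℤ) - ((t : ℤ) ^ 2 - 3 * t) / 2 + 1 ≤ (j : ℤ))
    (hjm : j ≤ m)
    (hfix : ∀ B : Fin 3 → ℂ, B ≠ 0 → MvPolynomial.eval B f = 0 →
      ∀ F ∈ LSys d j B Z, f ∣ F) :
    ∀ B : Fin 3 → ℂ, B ≠ 0 → MvPolynomial.eval B f = 0 →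
      (ZC.card : ℤ) + (j : ℤ) - (t : ℤ) * d + ((t : ℤ) ^ 2 - 3 * t) / 2 ≤
        (Module.finrank ℂ ↥(LSys d j B Z) : ℤ) -
          ((Nat.choose (d + 2) 2 : ℤ) - (Z.card : ℤ) - (Nat.choose (j + 1) 2 : ℤ)) := by
  intro B _ hB
  obtain ⟨e, rfl⟩ : ∃ e, d = e + t := ⟨d - t, by omega⟩
  obtain ⟨k, rfl⟩ : ∃ k, j = k + 1 := ⟨j - 1, by omega⟩
  have h := FixedComp.key e t k f hirr.ne_zero hf Z ZC hZC B hB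
  have h1 := FixedComp.choose_two_int (e + 1)
  have h2 := FixedComp.choose_two_int (e + t + 1)
  have h3 := FixedComp.choose_two_int k
  have h4 := FixedComp.choose_two_int (k + 1)
  have h5 : 2 * (((t : ℤ) ^ 2 - 3 * t) / 2) = (t : ℤ) ^ 2 - 3 * t := by
    apply Int.mul_ediv_cancel'
    have := (Int.even_mul_succ_self (t : ℤ)).two_dvd
    have h6 : (t : ℤ) ^ 2 - 3 * t = (t : ℤ) * (t + 1) - 2 * (2 * t) := by ring
    rw [h6]
    exact dvd_sub this (dvd_mul_right _ _)
  zify at h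
  push_cast at h h1 h2 h3 h4 ⊢
  nlinarith
end

section
/- Let P₁, P₂, P₃ be pairwise non-proportional nonzero vectors in ℂ³ that are linearly dependent (i.e., the three corresponding points of ℙ² are distinct and collinear), and let ℓ be a nonzero linear form vanishing at P₁, P₂, P₃. Then there exists a nonzero constant c ∈ ℂ such that, as polynomials in the variables (a₀,a₁,a₂), det M(2,2;{P₁,P₂,P₃};(a₀,a₁,a₂)) = c · ℓ(a₀,a₁,a₂)³. In particular, the zero locus of the interpolation determinant is the common line of the three points, counted with multiplicity 3. -/
open MvPolynomial

/-- The `6 × 6` interpolation matrix `M(2,2; {P₁,P₂,P₃}; a)`: the columns correspond to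
the monomial basis `(x², y², z², xy, xz, yz)` of degree-2 forms, the first three rows are
the evaluations of these monomials at `P₁, P₂, P₃`, and the last three rows are their
first-order partial derivatives evaluated at `a = (a₀, a₁, a₂)`. -/
noncomputable def M22 (P₁ P₂ P₃ a : Fin 3 → ℂ) : Matrix (Fin 6) (Fin 6) ℂ :=
  !![P₁ 0 ^ 2, P₁ 1 ^ 2, P₁ 2 ^ 2, P₁ 0 * P₁ 1, P₁ 0 * P₁ 2, P₁ 1 * P₁ 2;
     P₂ 0 ^ 2, P₂ 1 ^ 2, P₂ 2 ^ 2, P₂ 0 * P₂ 1, P₂ 0 * P₂ 2, P₂ 1 * P₂ 2;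
     P₃ 0 ^ 2, P₃ 1 ^ 2, P₃ 2 ^ 2, P₃ 0 * P₃ 1, P₃ 0 * P₃ 2, P₃ 1 * P₃ 2;
     2 * a 0, 0, 0, a 1, a 2, 0;
     0, 2 * a 1, 0, a 0, 0, a 2;
     0, 0, 2 * a 2, 0, a 0, a 1]

theorem aux_det (P Q a : Fin 3 → ℂ) (s t : ℂ) :
    (M22 P Q (s • P + t • Q) a).det = (-2 * s * t) *
      ((P 1 * Q 2 - P 2 * Q 1) * a 0 + (P 2 * Q 0 - P 0 * Q 2) * a 1
        + (P 0 * Q 1 - P 1 * Q 0) * a 2) ^ 3 := by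
  unfold M22
  simp only [Pi.add_apply, Pi.smul_apply, smul_eq_mul]
  generalize P 0 = p0
  generalize P 1 = p1
  generalize P 2 = p2
  generalize Q 0 = q0
  generalize Q 1 = q1
  generalize Q 2 = q2
  generalize a 0 = a0
  generalize a 1 = a1
  generalize a 2 = a2
  simp [Matrix.det_succ_row_zero, Fin.sum_univ_succ, Fin.succAbove]
  ring

/-- If `P₁, P₂, P₃` are distinct collinear points (pairwise non-proportional nonzero,
linearly dependent vectors of `ℂ³`) and `ℓ` is a nonzero linear form vanishing at all
three, then `det M(2,2;{P₁,P₂,P₃};a) = c · ℓ(a)³` for some nonzero constant `c`: the zero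
locus of the interpolation determinant is the common line, with multiplicity `3`. -/
theorem det_M22_collinear (P₁ P₂ P₃ : Fin 3 → ℂ)
    (h1 : P₁ ≠ 0) (h2 : P₂ ≠ 0) (h3 : P₃ ≠ 0)
    (h12 : ∀ c : ℂ, P₁ ≠ c • P₂) (h13 : ∀ c : ℂ, P₁ ≠ c • P₃)
    (h23 : ∀ c : ℂ, P₂ ≠ c • P₃)
    (hdep : ¬ LinearIndependent ℂ ![P₁, P₂, P₃])
    (ℓ : MvPolynomial (Fin 3) ℂ) (hl0 : ℓ ≠ 0) (hl : ℓ.IsHomogeneous 1)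
    (hv1 : MvPolynomial.eval P₁ ℓ = 0) (hv2 : MvPolynomial.eval P₂ ℓ = 0)
    (hv3 : MvPolynomial.eval P₃ ℓ = 0) :
    ∃ c : ℂ, c ≠ 0 ∧
      ∀ a : Fin 3 → ℂ, (M22 P₁ P₂ P₃ a).det = c * (MvPolynomial.eval a ℓ) ^ 3 := by
  -- the two points `P₁, P₂` span a plane
  have hc0 : crossProduct P₁ P₂ ≠ 0 := by
    rw [crossProduct_ne_zero_iff_linearIndependent]
    have := (LinearIndependent.pair_iff' (K := ℂ) h2 (y := P₁)).2
      (fun a h => h12 a h.symm)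
    exact LinearIndependent.pair_symm_iff.1 this
  -- write `P₃ = s P₁ + t P₂`
  obtain ⟨s, t, hst⟩ : ∃ s t : ℂ, P₃ = s • P₁ + t • P₂ := by
    obtain ⟨g, hg, i, hi⟩ := Fintype.not_linearIndependent_iff.1 hdep
    simp only [Fin.sum_univ_three, Matrix.cons_val] at hg
    have hg2 : g 2 ≠ 0 := by
      intro h
      rw [h, zero_smul, add_zero] at hg
      by_cases h0 : g 0 = 0
      · rw [h0, zero_smul, zero_add, smul_eq_zero] at hg
        have hg1 : g 1 = 0 := hg.resolve_right h2
        fin_cases i <;> simp_all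
      · apply h12 (-(g 1 / g 0))
        funext j
        have := congrFun hg j
        simp only [Pi.add_apply, Pi.smul_apply, smul_eq_mul, Pi.zero_apply] at this ⊢
        field_simp
        linear_combination this
    refine ⟨-(g 0 / g 2), -(g 1 / g 2), ?_⟩
    funext j
    have := congrFun hg j
    simp only [Pi.add_apply, Pi.smul_apply, smul_eq_mul, Pi.zero_apply] at this ⊢
    field_simp
    linear_combination this
  have hs : s ≠ 0 := by
    rintro rfl
    rw [zero_smul, zero_add] at hst
    have ht : t ≠ 0 := by
      rintro rfl
      exact h3 (by rw [hst, zero_smul])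
    exact h23 t⁻¹ (by rw [hst, smul_smul, inv_mul_cancel₀ ht, one_smul])
  have ht : t ≠ 0 := by
    rintro rfl
    rw [zero_smul, add_zero] at hst
    exact h13 s⁻¹ (by rw [hst, smul_smul, inv_mul_cancel₀ hs, one_smul])
  -- coefficients of the linear form
  obtain ⟨u, hu⟩ : ∃ u : Fin 3 → ℂ, ∑ i, u i • (X i : MvPolynomial (Fin 3) ℂ) = ℓ := by
    have h := (mem_homogeneousSubmodule 1 ℓ).2 hl
    rw [homogeneousSubmodule_one_eq_span_X] at h
    exact (Submodule.mem_span_range_iff_exists_fun ℂ).1 h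
  have hev : ∀ a, eval a ℓ = u 0 * a 0 + u 1 * a 1 + u 2 * a 2 := by
    intro a
    rw [← hu]
    simp [Fin.sum_univ_three, smul_eval]
  have hu0 : ∃ i, u i ≠ 0 := by
    by_contra! h
    exact hl0 (by rw [← hu]; simp [h])
  rw [hev] at hv1 hv2
  have hcr : ∀ i j, crossProduct P₁ P₂ j * u i = crossProduct P₁ P₂ i * u j := by
    intro i j
    rw [cross_apply]
    fin_cases i <;> fin_cases j <;> simp <;> first
      | ring1
      | linear_combination P₁ 0 * hv2 - P₂ 0 * hv1
      | linear_combination P₁ 1 * hv2 - P₂ 1 * hv1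
      | linear_combination P₁ 2 * hv2 - P₂ 2 * hv1
      | linear_combination P₂ 0 * hv1 - P₁ 0 * hv2
      | linear_combination P₂ 1 * hv1 - P₁ 1 * hv2
      | linear_combination P₂ 2 * hv1 - P₁ 2 * hv2
  obtain ⟨i, hi⟩ := hu0
  obtain ⟨m, hm⟩ : ∃ m : ℂ, ∀ j, crossProduct P₁ P₂ j = m * u j := by
    refine ⟨crossProduct P₁ P₂ i / u i, fun j => ?_⟩
    field_simp
    exact hcr i j
  have hm0 : m ≠ 0 := by
    rintro rfl
    exact hc0 (funext fun j => by simp [hm])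
  refine ⟨-2 * s * t * m ^ 3, by simp [hs, ht, hm0], fun a => ?_⟩
  rw [hst, aux_det, hev]
  have e0 := hm 0
  have e1 := hm 1
  have e2 := hm 2
  simp only [cross_apply, Matrix.cons_val] at e0 e1 e2
  rw [e0, e1, e2]
  ring
end

section
/- Let P₁, P₂, P₃ be linearly independent vectors in ℂ³ (i.e., three non-collinear points of ℙ²). For each pair i < j let ℓ_{ij} be a nonzero linear form vanishing at Pᵢ and P_j. Then there exists a nonzero constant c ∈ ℂ such that, as polynomials in the variables (a₀,a₁,a₂), det M(2,2;{P₁,P₂,P₃};(a₀,a₁,a₂)) = c · ℓ_{12}(a₀,a₁,a₂) · ℓ_{13}(a₀,a₁,a₂) · ℓ_{23}(a₀,a₁,a₂). In particular, the zero locus of the interpolation determinant is exactly the union of the three lines through the pairs of points. -/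
open MvPolynomial

def D3 (P Q a : Fin 3 → ℂ) : ℂ :=
  (P 1 * Q 2 - P 2 * Q 1) * a 0 + (P 2 * Q 0 - P 0 * Q 2) * a 1 + (P 0 * Q 1 - P 1 * Q 0) * a 2

set_option maxHeartbeats 4000000 in
lemma det_M22_eq (P Q R a : Fin 3 → ℂ) :
    (M22 P Q R a).det = 2 * D3 P Q a * D3 P R a * D3 Q R a := by
  unfold M22 D3
  simp [Matrix.det_succ_row_zero, Fin.sum_univ_succ, Fin.succAbove]
  ring

lemma eval_lin (l : MvPolynomial (Fin 3) ℂ) (hl : l.IsHomogeneous 1) :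
    ∃ u : Fin 3 → ℂ, ∀ a, MvPolynomial.eval a l = u 0 * a 0 + u 1 * a 1 + u 2 * a 2 := by
  have h : l ∈ homogeneousSubmodule (Fin 3) ℂ 1 := hl
  rw [homogeneousSubmodule_one_eq_span_X] at h
  clear hl
  induction h using Submodule.span_induction with
  | mem x hx =>
    obtain ⟨i, rfl⟩ := hx
    refine ⟨Pi.single i 1, fun a => ?_⟩
    fin_cases i <;> simp
  | zero => exact ⟨0, by simp⟩
  | add x y _ _ hx hy =>
    obtain ⟨u, hu⟩ := hx
    obtain ⟨v, hv⟩ := hy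
    exact ⟨u + v, fun a => by simp [hu, hv]; ring⟩
  | smul c x _ hx =>
    obtain ⟨u, hu⟩ := hx
    exact ⟨c • u, fun a => by simp [hu]; ring⟩

lemma lin_prop (P Q R : Fin 3 → ℂ) (hR : D3 P Q R ≠ 0) (l : MvPolynomial (Fin 3) ℂ)
    (h0 : l ≠ 0) (hl : l.IsHomogeneous 1) (hP : MvPolynomial.eval P l = 0)
    (hQ : MvPolynomial.eval Q l = 0) :
    ∃ s : ℂ, s ≠ 0 ∧ ∀ a, D3 P Q a = s * MvPolynomial.eval a l := by
  obtain ⟨u, hu⟩ := eval_lin l hl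
  rw [hu] at hP hQ
  have key : ∀ a, D3 P Q R * MvPolynomial.eval a l = MvPolynomial.eval R l * D3 P Q a := by
    intro a
    rw [hu, hu]
    unfold D3
    have h0 : u 1 * (P 0 * Q 1 - P 1 * Q 0) = u 2 * (P 2 * Q 0 - P 0 * Q 2) := by
      linear_combination Q 0 * (-hP) + P 0 * hQ
    have h1 : u 2 * (P 1 * Q 2 - P 2 * Q 1) = u 0 * (P 0 * Q 1 - P 1 * Q 0) := by
      linear_combination Q 1 * (-hP) + P 1 * hQ
    have h2 : u 0 * (P 2 * Q 0 - P 0 * Q 2) = u 1 * (P 1 * Q 2 - P 2 * Q 1) := by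
      linear_combination Q 2 * (-hP) + P 2 * hQ
    linear_combination (R 2 * a 1 - R 1 * a 2) * h0 + (R 0 * a 2 - R 2 * a 0) * h1 +
      (R 1 * a 0 - R 0 * a 1) * h2
  have hlR : MvPolynomial.eval R l ≠ 0 := by
    intro h
    apply h0
    apply MvPolynomial.funext
    intro a
    have := key a
    rw [h, zero_mul] at this
    simpa [hR] using this
  refine ⟨D3 P Q R / MvPolynomial.eval R l, div_ne_zero hR hlR, fun a => ?_⟩
  field_simp
  linear_combination -(key a)

/-- If `P₁, P₂, P₃` are three non-collinear points (linearly independent vectors of `ℂ³`)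
and `ℓ₁₂, ℓ₁₃, ℓ₂₃` are nonzero linear forms vanishing at the corresponding pairs of
points, then `det M(2,2;{P₁,P₂,P₃};a) = c · ℓ₁₂(a) · ℓ₁₃(a) · ℓ₂₃(a)` for some nonzero
constant `c`: the zero locus of the interpolation determinant is exactly the union of the
three lines through the pairs of points. -/
theorem det_M22_noncollinear (P₁ P₂ P₃ : Fin 3 → ℂ)
    (hind : LinearIndependent ℂ ![P₁, P₂, P₃])
    (l12 l13 l23 : MvPolynomial (Fin 3) ℂ)
    (h12 : l12 ≠ 0) (h13 : l13 ≠ 0) (h23 : l23 ≠ 0)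
    (hh12 : l12.IsHomogeneous 1) (hh13 : l13.IsHomogeneous 1) (hh23 : l23.IsHomogeneous 1)
    (hv12a : MvPolynomial.eval P₁ l12 = 0) (hv12b : MvPolynomial.eval P₂ l12 = 0)
    (hv13a : MvPolynomial.eval P₁ l13 = 0) (hv13b : MvPolynomial.eval P₃ l13 = 0)
    (hv23a : MvPolynomial.eval P₂ l23 = 0) (hv23b : MvPolynomial.eval P₃ l23 = 0) :
    ∃ c : ℂ, c ≠ 0 ∧
      ∀ a : Fin 3 → ℂ,
        (M22 P₁ P₂ P₃ a).det =
          c * MvPolynomial.eval a l12 * MvPolynomial.eval a l13 *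
            MvPolynomial.eval a l23 := by
  have hd : D3 P₁ P₂ P₃ ≠ 0 := by
    have h1 : IsUnit (Matrix.of ![P₁, P₂, P₃]) :=
      Matrix.linearIndependent_rows_iff_isUnit.mp hind
    have h2 := ((Matrix.isUnit_iff_isUnit_det _).mp h1).ne_zero
    intro h
    apply h2
    rw [← h, Matrix.det_fin_three]
    simp [D3]
    ring
  have hd2 : D3 P₁ P₃ P₂ ≠ 0 := by
    intro h
    apply hd
    unfold D3 at *
    linear_combination -h
  have hd3 : D3 P₂ P₃ P₁ ≠ 0 := by
    intro h
    apply hd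
    unfold D3 at *
    linear_combination h
  obtain ⟨s, hs, hs'⟩ := lin_prop _ _ _ hd l12 h12 hh12 hv12a hv12b
  obtain ⟨t, ht, ht'⟩ := lin_prop _ _ _ hd2 l13 h13 hh13 hv13a hv13b
  obtain ⟨r, hr, hr'⟩ := lin_prop _ _ _ hd3 l23 h23 hh23 hv23a hv23b
  refine ⟨2 * s * t * r, by simp [hs, ht, hr], fun a => ?_⟩
  rw [det_M22_eq, hs', ht', hr']
  ring
end
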